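/- arXiv:2202.00954 — 3 statements merged into one kernel-verified Lean document; each statement's English description precedes it below -/
import Mathlib

section
/- For each k = 1,…,N, let π̃^k ∈ Π(μ¹,…,μ^N) be a plan satisfying ∫ ‖x_k − x_i‖² dπ̃^k = W₂²(μ^k, μ^i) for all i ≠ k (the output of the reference iteration with reference measure μ^k). Then the λ-weighted average satisfies Σ_{k=1}^N λ_k Φ(π̃^k) ≤ 2 · Φ(π̂) for every optimal plan π̂ minimizing Φ over Π(μ¹,…,μ^N); i.e. choosing the reference measure μ^k at random with probability λ_k yields an expected cost at most twice the optimum. -/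
open MeasureTheory
open scoped ENNReal

noncomputable section

/-- Points of the `d`-dimensional Euclidean space. -/
abbrev Pt (d : ℕ) := EuclideanSpace ℝ (Fin d)

/-- A measure is finitely supported if it vanishes outside a finite set. -/
def FinitelySupported {α : Type*} [MeasurableSpace α] (μ : Measure α) : Prop :=
  ∃ s : Finset α, μ ((s : Set α)ᶜ) = 0

/-- `λ` lies in the open probability simplex. -/
def InSimplex {N : ℕ} (l : Fin N → ℝ) : Prop :=
  (∀ i, 0 < l i) ∧ ∑ i, l i = 1

/-- `π` is a multi-marginal transport plan with marginals `μ i`. -/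
def IsPlan {d N : ℕ} (μ : Fin N → Measure (Pt d)) (π : Measure (Fin N → Pt d)) : Prop :=
  IsProbabilityMeasure π ∧ ∀ i, π.map (fun x => x i) = μ i

/-- The multi-marginal optimal transport cost `Φ(π)`. -/
def MOT {d N : ℕ} (l : Fin N → ℝ) (π : Measure (Fin N → Pt d)) : ℝ≥0∞ :=
  ∫⁻ x, ∑ s : Fin N, ∑ t : Fin N,
    (if s < t then ENNReal.ofReal (l s * l t * ‖x s - x t‖ ^ 2) else 0) ∂π

/-- `π` is a coupling of `μ` and `ν`. -/
def IsCoupling {α : Type*} [MeasurableSpace α] (μ ν : Measure α) (π : Measure (α × α)) : Prop :=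
  IsProbabilityMeasure π ∧ π.map Prod.fst = μ ∧ π.map Prod.snd = ν

/-- The squared Wasserstein-2 distance: the optimal squared-Euclidean transport cost
over all couplings. -/
def W2sq {d : ℕ} (μ ν : Measure (Pt d)) : ℝ≥0∞ :=
  sInf { c : ℝ≥0∞ | ∃ π : Measure (Pt d × Pt d), IsCoupling μ ν π ∧
    c = ∫⁻ p, ENNReal.ofReal (‖p.1 - p.2‖ ^ 2) ∂π }

/-- The barycenter objective `Ψ(ν) = ∑ i λ i * W₂²(μ i, ν)`. -/
def Psi {d N : ℕ} (l : Fin N → ℝ) (μ : Fin N → Measure (Pt d)) (ν : Measure (Pt d)) : ℝ≥0∞ :=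
  ∑ i, ENNReal.ofReal (l i) * W2sq (μ i) ν

/-- The `λ`-weighted mean map `M_λ`. -/
def wmean {d N : ℕ} (l : Fin N → ℝ) (x : Fin N → Pt d) : Pt d :=
  ∑ i, l i • x i

/-- The support-as-atoms of a measure. -/
def msupport {α : Type*} [MeasurableSpace α] (μ : Measure α) : Set α :=
  {x | μ {x} ≠ 0}

lemma aux_symm {M : Type*} [AddCommMonoid M] {N : ℕ} (f : Fin N → Fin N → M)
    (hs : ∀ s t, f s t = f t s) (h0 : ∀ s, f s s = 0) :
    ∑ s, ∑ t, f s t = 2 • ∑ s, ∑ t, (if s < t then f s t else 0) := by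
  have h1 : ∀ s t, f s t = (if s < t then f s t else 0) + (if t < s then f t s else 0) := by
    intro s t
    rcases lt_trichotomy s t with h | h | h
    · simp [h, h.not_gt]
    · subst h; simp [h0]
    · simp [h, h.not_gt, hs s t]
  calc ∑ s, ∑ t, f s t
      = ∑ s, ∑ t, ((if s < t then f s t else 0) + (if t < s then f t s else 0)) :=
        Finset.sum_congr rfl fun s _ => Finset.sum_congr rfl fun t _ => h1 s t
    _ = ∑ s, ∑ t, (if s < t then f s t else 0) + ∑ s, ∑ t, (if t < s then f t s else 0) := by
        simp only [Finset.sum_add_distrib]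
    _ = _ := by rw [Finset.sum_comm (f := fun s t => if t < s then f t s else 0), two_nsmul]

lemma aux_real {d N : ℕ} (l : Fin N → ℝ) (hl : InSimplex l) (y : Fin N → Pt d) :
    ∑ s, ∑ t, l s * l t * ‖y s - y t‖ ^ 2 ≤ 2 * ∑ t, l t * ‖y t‖ ^ 2 := by
  have h2 : ∑ s, ∑ t, l s * l t * inner ℝ (y s) (y t) = ‖∑ i, l i • y i‖ ^ 2 := by
    rw [← real_inner_self_eq_norm_sq, sum_inner]
    refine Finset.sum_congr rfl fun s _ => ?_
    rw [inner_sum]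
    refine Finset.sum_congr rfl fun t _ => ?_
    rw [real_inner_smul_left, real_inner_smul_right, mul_assoc]
  have hA : ∑ s, ∑ t, l s * l t * ‖y s‖ ^ 2 = ∑ t, l t * ‖y t‖ ^ 2 := by
    refine Finset.sum_congr rfl fun s _ => ?_
    calc ∑ t, l s * l t * ‖y s‖ ^ 2 = ∑ t, (l s * ‖y s‖ ^ 2) * l t :=
          Finset.sum_congr rfl fun t _ => by ring
      _ = _ := by rw [← Finset.mul_sum, hl.2, mul_one]
  have hB : ∑ s, ∑ t, l s * l t * ‖y t‖ ^ 2 = ∑ t, l t * ‖y t‖ ^ 2 := by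
    rw [Finset.sum_comm, ← hA]
    exact Finset.sum_congr rfl fun s _ => Finset.sum_congr rfl fun t _ => by ring
  have h3 : ∑ s, ∑ t, l s * l t * ‖y s - y t‖ ^ 2
      = ∑ s, ∑ t, l s * l t * ‖y s‖ ^ 2 + ∑ s, ∑ t, l s * l t * ‖y t‖ ^ 2
        - 2 * ∑ s, ∑ t, l s * l t * inner ℝ (y s) (y t) := by
    simp only [Finset.mul_sum, ← Finset.sum_add_distrib, ← Finset.sum_sub_distrib]
    refine Finset.sum_congr rfl fun s _ => Finset.sum_congr rfl fun t _ => ?_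
    rw [norm_sub_sq_real]; ring
  rw [h3, hA, hB, h2]
  nlinarith [sq_nonneg ‖∑ i, l i • y i‖]

lemma aux_pt {d N : ℕ} (l : Fin N → ℝ) (hl : InSimplex l) (x : Fin N → Pt d) (k : Fin N) :
    ∑ s : Fin N, ∑ t : Fin N,
      (if s < t then ENNReal.ofReal (l s * l t * ‖x s - x t‖ ^ 2) else 0)
    ≤ ∑ i, ENNReal.ofReal (l i) * ENNReal.ofReal (‖x k - x i‖ ^ 2) := by
  have hn : ∀ s t, 0 ≤ l s * l t * ‖x s - x t‖ ^ 2 := fun s t =>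
    mul_nonneg (mul_nonneg (hl.1 s).le (hl.1 t).le) (sq_nonneg _)
  have hL : ∑ s : Fin N, ∑ t : Fin N,
      (if s < t then ENNReal.ofReal (l s * l t * ‖x s - x t‖ ^ 2) else 0)
      = ENNReal.ofReal (∑ s, ∑ t, if s < t then l s * l t * ‖x s - x t‖ ^ 2 else 0) := by
    rw [ENNReal.ofReal_sum_of_nonneg]
    · refine Finset.sum_congr rfl fun s _ => ?_
      rw [ENNReal.ofReal_sum_of_nonneg]
      · refine Finset.sum_congr rfl fun t _ => ?_
        split_ifs <;> simp
      · intro t _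
        split_ifs
        exacts [hn s t, le_rfl]
    · intro s _
      refine Finset.sum_nonneg fun t _ => ?_
      split_ifs
      exacts [hn s t, le_rfl]
  have hR : ∑ i, ENNReal.ofReal (l i) * ENNReal.ofReal (‖x k - x i‖ ^ 2)
      = ENNReal.ofReal (∑ i, l i * ‖x k - x i‖ ^ 2) := by
    rw [ENNReal.ofReal_sum_of_nonneg
      (fun i _ => mul_nonneg (hl.1 i).le (sq_nonneg _))]
    exact Finset.sum_congr rfl fun i _ => (ENNReal.ofReal_mul (hl.1 i).le).symm
  rw [hL, hR]
  apply ENNReal.ofReal_le_ofReal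
  have h := aux_real l hl (fun i => x k - x i)
  have h' := aux_symm (fun s t => l s * l t * ‖x s - x t‖ ^ 2)
    (fun s t => by rw [norm_sub_rev]; ring) (fun s => by simp)
  have h'' : ∑ s, ∑ t, l s * l t * ‖(x k - x s) - (x k - x t)‖ ^ 2
      = ∑ s, ∑ t, l s * l t * ‖x s - x t‖ ^ 2 := by
    refine Finset.sum_congr rfl fun s _ => Finset.sum_congr rfl fun t _ => ?_
    rw [sub_sub_sub_cancel_left, norm_sub_rev]
  simp only [nsmul_eq_mul, Nat.cast_ofNat] at h'
  rw [h'', h'] at h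
  linarith

lemma aux_W {d N : ℕ} (μ : Fin N → Measure (Pt d)) (π : Measure (Fin N → Pt d))
    (hπ : IsPlan μ π) (k i : Fin N) :
    W2sq (μ k) (μ i) ≤ ∫⁻ x, ENNReal.ofReal (‖x k - x i‖ ^ 2) ∂π := by
  have := hπ.1
  have hm : Measurable (fun x : Fin N → Pt d => (x k, x i)) := by fun_prop
  refine sInf_le ⟨π.map (fun x => (x k, x i)),
    ⟨Measure.isProbabilityMeasure_map hm.aemeasurable, ?_, ?_⟩, ?_⟩
  · rw [Measure.map_map measurable_fst hm]; exact hπ.2 k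
  · rw [Measure.map_map measurable_snd hm]; exact hπ.2 i
  · rw [lintegral_map (by fun_prop) hm]

/-- If for every `k` the plan `π̃^k ∈ Π(μ¹,…,μ^N)` satisfies
`∫ ‖x_k − x_i‖² dπ̃^k = W₂²(μ^k, μ^i)` for all `i ≠ k` (reference algorithm with
reference measure `μ^k`), then `Σ_k λ_k Φ(π̃^k) ≤ 2 Φ(π̂)` for every optimal `π̂`. -/
theorem stmt12 {d N : ℕ} (μ : Fin N → Measure (Pt d))
    (hμ : ∀ i, IsProbabilityMeasure (μ i) ∧ FinitelySupported (μ i))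
    (l : Fin N → ℝ) (hl : InSimplex l)
    (pitil : Fin N → Measure (Fin N → Pt d)) (hplan : ∀ k, IsPlan μ (pitil k))
    (hwass : ∀ k i : Fin N, i ≠ k →
      (∫⁻ x, ENNReal.ofReal (‖x k - x i‖ ^ 2) ∂(pitil k)) = W2sq (μ k) (μ i)) :
    ∀ pihat, IsPlan μ pihat → (∀ π, IsPlan μ π → MOT l pihat ≤ MOT l π) →
      ∑ k, ENNReal.ofReal (l k) * MOT l (pitil k) ≤ 2 * MOT l pihat := by
  intro pihat hp _
  have hf : ∀ k i : Fin N, Measurable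
      (fun x : Fin N → Pt d => ENNReal.ofReal (‖x k - x i‖ ^ 2)) := by
    intro k i; fun_prop
  have h1 : ∀ k, MOT l (pitil k)
      ≤ ∑ i, ENNReal.ofReal (l i) * ∫⁻ x, ENNReal.ofReal (‖x k - x i‖ ^ 2) ∂pihat := by
    intro k
    calc MOT l (pitil k)
        ≤ ∫⁻ x, ∑ i, ENNReal.ofReal (l i) * ENNReal.ofReal (‖x k - x i‖ ^ 2) ∂(pitil k) :=
          lintegral_mono fun x => aux_pt l hl x k
      _ = ∑ i, ENNReal.ofReal (l i) * ∫⁻ x, ENNReal.ofReal (‖x k - x i‖ ^ 2) ∂(pitil k) := by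
          rw [lintegral_finsetSum _ (fun i _ => (hf k i).const_mul _)]
          exact Finset.sum_congr rfl fun i _ => lintegral_const_mul _ (hf k i)
      _ ≤ _ := by
          refine Finset.sum_le_sum fun i _ => ?_
          refine mul_le_mul_right ?_ _
          by_cases hik : i = k
          · subst hik; simp
          · rw [hwass k i hik]; exact aux_W μ pihat hp k i
  have h2 : 2 * MOT l pihat = ∑ k, ∑ i, ENNReal.ofReal (l k) *
      (ENNReal.ofReal (l i) * ∫⁻ x, ENNReal.ofReal (‖x k - x i‖ ^ 2) ∂pihat) := by
    rw [aux_symm (fun k i => ENNReal.ofReal (l k) *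
      (ENNReal.ofReal (l i) * ∫⁻ x, ENNReal.ofReal (‖x k - x i‖ ^ 2) ∂pihat))
      (fun s t => by simp only [norm_sub_rev]; ring) (fun s => by simp)]
    rw [nsmul_eq_mul, Nat.cast_ofNat]
    congr 1
    have hg : ∀ s t : Fin N, Measurable (fun x : Fin N → Pt d =>
        if s < t then ENNReal.ofReal (l s * l t * ‖x s - x t‖ ^ 2) else 0) := by
      intro s t
      split_ifs <;> fun_prop
    unfold MOT
    rw [lintegral_finsetSum _ (fun s _ => Finset.measurable_fun_sum _ fun t _ => hg s t)]
    refine Finset.sum_congr rfl fun s _ => ?_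
    rw [lintegral_finsetSum _ (fun t _ => hg s t)]
    refine Finset.sum_congr rfl fun t _ => ?_
    split_ifs
    · rw [← mul_assoc, ← ENNReal.ofReal_mul (hl.1 s).le, ← lintegral_const_mul _ (hf s t)]
      simp only [← ENNReal.ofReal_mul (mul_nonneg (hl.1 s).le (hl.1 t).le)]
    · simp
  rw [h2]
  refine Finset.sum_le_sum fun k _ => ?_
  rw [← Finset.mul_sum]
  gcongr
  exact h1 k
end
end

section
/- Assume λ₁ ≥ λ₂ ≥ … ≥ λ_N. Let π̃ = π̃^{(N)} be obtained by the greedy iteration: π̃^{(1)} = μ¹, and for r = 2,…,N, π̃^{(r)} is a probability measure on (ℝ^d)^r minimizing ∫ ‖Σ_{i=1}^{r−1} λ̄_{i,r−1} x_i − x_r‖² dπ over all probability measures on (ℝ^d)^r whose projection onto the first r−1 coordinates equals π̃^{(r−1)} and whose r-th coordinate marginal equals μ^r, where λ̄_{i,r−1} = λ_i / (λ₁ + … + λ_{r−1}). Then Φ(π̃) ≤ ((2N² − 5)/3) · Φ(π̂) for every optimal plan π̂ minimizing Φ over Π(μ¹,…,μ^N). -/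
open MeasureTheory
open scoped ENNReal

noncomputable section

/-- Admissibility for one step of the sequential (reference/greedy) iteration:
`Q` is a probability measure on `(ℝ^d)^(r+1)` whose projection onto the first `r`
coordinates is `prev` and whose last marginal is `μr`. -/
def StepAdmissible {d r : ℕ} (prev : Measure (Fin r → Pt d)) (μr : Measure (Pt d))
    (Q : Measure (Fin (r + 1) → Pt d)) : Prop :=
  IsProbabilityMeasure Q ∧
    Q.map (fun x (i : Fin r) => x i.castSucc) = prev ∧
    Q.map (fun x => x (Fin.last r)) = μr

/-- The cost minimized at step `r+1` of the reference algorithm: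
`∫ ‖x₁ − x_{r+1}‖² dQ`. -/
def refCost {d r : ℕ} (Q : Measure (Fin (r + 1) → Pt d)) : ℝ≥0∞ :=
  ∫⁻ x, ENNReal.ofReal (‖x 0 - x (Fin.last r)‖ ^ 2) ∂Q

/-- One step of the reference algorithm: `next` is admissible and minimizes the
reference cost among all admissible measures. -/
def RefStep {d r : ℕ} (prev : Measure (Fin r → Pt d)) (μr : Measure (Pt d))
    (next : Measure (Fin (r + 1) → Pt d)) : Prop :=
  StepAdmissible prev μr next ∧
    ∀ Q, StepAdmissible prev μr Q → refCost next ≤ refCost Q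

/-- The cost minimized at step `r+1` of the greedy algorithm:
`∫ ‖Σ_{i≤r} (λ_i / Σ_{j≤r} λ_j) x_i − x_{r+1}‖² dQ`, where `lr` are the
weights of the first `r` measures. -/
def greedyCost {d r : ℕ} (lr : Fin r → ℝ) (Q : Measure (Fin (r + 1) → Pt d)) : ℝ≥0∞ :=
  ∫⁻ x, ENNReal.ofReal
    (‖(∑ i : Fin r, (lr i / ∑ j : Fin r, lr j) • x i.castSucc) - x (Fin.last r)‖ ^ 2) ∂Q

/-- One step of the greedy algorithm: `next` is admissible and minimizes the
greedy cost among all admissible measures. -/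
def GreedyStep {d r : ℕ} (lr : Fin r → ℝ) (prev : Measure (Fin r → Pt d))
    (μr : Measure (Pt d)) (next : Measure (Fin (r + 1) → Pt d)) : Prop :=
  StepAdmissible prev μr next ∧
    ∀ Q, StepAdmissible prev μr Q → greedyCost lr next ≤ greedyCost lr Q

/-- Barycenter identity. -/
lemma bary_identity {d n : ℕ} (l : Fin n → ℝ) (hS : ∑ j, l j ≠ 0) (x : Fin n → Pt d) (y : Pt d) :
    ∑ k, l k * ‖x k - y‖ ^ 2 =
      (∑ j, l j) * ‖(∑ i, (l i / ∑ j, l j) • x i) - y‖ ^ 2 +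
        ∑ k, l k * ‖x k - ∑ i, (l i / ∑ j, l j) • x i‖ ^ 2 := by
  set S := ∑ j, l j with hSdef
  set m := ∑ i, (l i / S) • x i with hm
  have hSm : S • m = ∑ i, l i • x i := by
    rw [hm, Finset.smul_sum]
    refine Finset.sum_congr rfl fun i _ => ?_
    rw [smul_smul, mul_div_cancel₀ _ hS]
  have h0 : ∑ k, l k • (x k - m) = 0 := by
    simp only [smul_sub, Finset.sum_sub_distrib, ← Finset.sum_smul]
    rw [← hSdef, hSm, sub_self]
  have hcross : ∑ k, l k * inner ℝ (x k - m) (m - y) = 0 := by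
    have : ∑ k, l k * inner ℝ (x k - m) (m - y) = inner ℝ (∑ k, l k • (x k - m)) (m - y) := by
      rw [sum_inner]
      refine Finset.sum_congr rfl fun i _ => ?_
      rw [real_inner_smul_left]
    rw [this, h0, inner_zero_left]
  have hk : ∀ k, l k * ‖x k - y‖ ^ 2 =
      l k * ‖x k - m‖ ^ 2 + 2 * (l k * inner ℝ (x k - m) (m - y)) + l k * ‖m - y‖ ^ 2 := by
    intro k
    have : x k - y = (x k - m) + (m - y) := by abel
    rw [this, norm_add_sq_real]
    ring
  rw [Finset.sum_congr rfl fun k _ => hk k, Finset.sum_add_distrib, Finset.sum_add_distrib,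
    ← Finset.mul_sum, hcross, ← Finset.sum_mul]
  ring

/-- A symmetric double sum with zero diagonal is twice its upper triangle. -/
lemma half_sum {n : ℕ} (f : Fin n → Fin n → ℝ) (hsym : ∀ s t, f s t = f t s)
    (hdiag : ∀ s, f s s = 0) :
    2 * ∑ s, ∑ t, (if s < t then f s t else 0) = ∑ s, ∑ t, f s t := by
  have h1 : ∑ s, ∑ t, (if s < t then f s t else 0) = ∑ s, ∑ t, (if t < s then f s t else 0) := by
    rw [Finset.sum_comm]
    refine Finset.sum_congr rfl fun s _ => Finset.sum_congr rfl fun t _ => ?_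
    rw [hsym]
  rw [two_mul]
  nth_rewrite 2 [h1]
  rw [← Finset.sum_add_distrib]
  refine Finset.sum_congr rfl fun s _ => ?_
  rw [← Finset.sum_add_distrib]
  refine Finset.sum_congr rfl fun t _ => ?_
  rcases lt_trichotomy s t with h | h | h
  · simp [h, h.not_gt]
  · subst h; simp [hdiag]
  · simp [h, h.not_gt]

lemma pair_identity {d n : ℕ} (l : Fin n → ℝ) (hS : ∑ j, l j ≠ 0) (x : Fin n → Pt d) :
    ∑ s, ∑ t, (if s < t then l s * l t * ‖x s - x t‖ ^ 2 else 0) =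
      (∑ j, l j) * ∑ k, l k * ‖x k - ∑ i, (l i / ∑ j, l j) • x i‖ ^ 2 := by
  have h := half_sum (fun s t => l s * l t * ‖x s - x t‖ ^ 2)
    (fun s t => by rw [norm_sub_rev]; ring) (fun s => by simp)
  have h2 : ∑ s, ∑ t, l s * l t * ‖x s - x t‖ ^ 2 =
      2 * ((∑ j, l j) * ∑ k, l k * ‖x k - ∑ i, (l i / ∑ j, l j) • x i‖ ^ 2) := by
    rw [Finset.sum_comm]
    have : ∀ t, ∑ s, l s * l t * ‖x s - x t‖ ^ 2 = l t * ∑ s, l s * ‖x s - x t‖ ^ 2 := by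
      intro t
      rw [Finset.mul_sum]
      exact Finset.sum_congr rfl fun s _ => by ring
    rw [Finset.sum_congr rfl fun t _ => (this t).trans
      (congrArg (fun z => l t * z) (bary_identity l hS x (x t)))]
    simp only [mul_add, Finset.sum_add_distrib, ← Finset.sum_mul]
    rw [two_mul]
    congr 1
    rw [Finset.mul_sum]
    refine Finset.sum_congr rfl fun t _ => ?_
    rw [norm_sub_rev]
    ring
  linarith

lemma measurable_proj {d n : ℕ} :
    Measurable (fun (x : Fin (n + 1) → Pt d) (i : Fin n) => x i.castSucc) := by
  fun_prop

lemma MOT_eq {d n : ℕ} (l : Fin n → ℝ) (Q : Measure (Fin n → Pt d)) :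
    MOT l Q = ∑ s, ∑ t, if s < t then
      ∫⁻ x, ENNReal.ofReal (l s * l t * ‖x s - x t‖ ^ 2) ∂Q else 0 := by
  unfold MOT
  rw [lintegral_finsetSum _ (fun s _ => Finset.measurable_sum _ fun t _ => by
    split_ifs <;> fun_prop)]
  refine Finset.sum_congr rfl fun s _ => ?_
  rw [lintegral_finsetSum _ (fun t _ => by split_ifs <;> fun_prop)]
  refine Finset.sum_congr rfl fun t _ => ?_
  split_ifs <;> simp

lemma MOT_succ {d n : ℕ} (l : Fin (n + 1) → ℝ) (hl : ∀ i, 0 < l i)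
    (Q : Measure (Fin (n + 1) → Pt d)) :
    MOT l Q = MOT (fun i : Fin n => l i.castSucc) (Q.map (fun x (i : Fin n) => x i.castSucc)) +
      ENNReal.ofReal (l (Fin.last n)) * ∑ k : Fin n, ENNReal.ofReal (l k.castSucc) *
        ∫⁻ x, ENNReal.ofReal (‖x k.castSucc - x (Fin.last n)‖ ^ 2) ∂Q := by
  rw [MOT_eq, MOT_eq, Fin.sum_univ_castSucc]
  have hlast : ∑ t, (if Fin.last n < t then
      ∫⁻ x, ENNReal.ofReal (l (Fin.last n) * l t * ‖x (Fin.last n) - x t‖ ^ 2) ∂Q else 0) = 0 := by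
    refine Finset.sum_eq_zero fun t _ => ?_
    rw [if_neg (Fin.le_last t).not_gt]
  rw [hlast, add_zero, Finset.mul_sum, ← Finset.sum_add_distrib]
  refine Finset.sum_congr rfl fun s _ => ?_
  rw [Fin.sum_univ_castSucc]
  congr 1
  · refine Finset.sum_congr rfl fun t _ => ?_
    simp only [Fin.castSucc_lt_castSucc_iff]
    split_ifs with h
    · rw [lintegral_map (by fun_prop) measurable_proj]
    · rfl
  · rw [if_pos (Fin.castSucc_lt_last s), ← mul_assoc,
      ← ENNReal.ofReal_mul (hl _).le, ← lintegral_const_mul _ (by fun_prop)]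
    refine lintegral_congr fun x => ?_
    rw [← ENNReal.ofReal_mul (mul_pos (hl _) (hl _)).le]
    congr 1
    ring

/-- Gluing competitor. -/
lemma competitor {d n : ℕ} (prev : Measure (Fin n → Pt d)) [IsProbabilityMeasure prev]
    (ν : Measure (Pt d × Pt d)) [IsProbabilityMeasure ν] (k : Fin n)
    (hk : prev.map (fun x => x k) = ν.fst) :
    ∃ Q : Measure (Fin (n + 1) → Pt d), StepAdmissible prev ν.snd Q ∧
      Q.map (fun x => (x k.castSucc, x (Fin.last n))) = ν := by
  let κ : ProbabilityTheory.Kernel (Fin n → Pt d) (Pt d) :=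
    ν.condKernel.comap (fun x => x k) (measurable_pi_apply k)
  let g : (Fin n → Pt d) × Pt d → (Fin (n + 1) → Pt d) :=
    fun p => Fin.snoc (α := fun _ => Pt d) p.1 p.2
  have hg : Measurable g := by
    refine measurable_pi_iff.2 fun i => ?_
    refine Fin.lastCases ?_ (fun j => ?_) i
    · simp only [g, Fin.snoc_last]; fun_prop
    · simp only [g, Fin.snoc_castSucc]; fun_prop
  have hpair : (prev.compProd κ).map (fun p => (p.1 k, p.2)) = ν := by
    refine Measure.ext_of_lintegral _ fun f hf => ?_
    rw [lintegral_map hf (by fun_prop), Measure.lintegral_compProd (by fun_prop)]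
    conv_rhs => rw [← ν.disintegrate ν.condKernel, Measure.lintegral_compProd hf, ← hk]
    rw [lintegral_map (Measurable.lintegral_kernel_prod_right' hf) (by fun_prop)]
    rfl
  refine ⟨(prev.compProd κ).map g, ⟨?_, ?_, ?_⟩, ?_⟩
  · exact Measure.isProbabilityMeasure_map hg.aemeasurable
  · rw [Measure.map_map measurable_proj hg]
    have : (fun (x : Fin (n + 1) → Pt d) (i : Fin n) => x i.castSucc) ∘ g = Prod.fst := by
      ext p; simp [g]
    rw [this]
    exact Measure.fst_compProd prev κ
  · rw [Measure.map_map (by fun_prop) hg]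
    have : (fun (x : Fin (n + 1) → Pt d) => x (Fin.last n)) ∘ g =
        Prod.snd ∘ (fun p : (Fin n → Pt d) × Pt d => (p.1 k, p.2)) := by
      ext p; simp [g]
    rw [this, ← Measure.map_map (by fun_prop) (by fun_prop), hpair]
    rfl
  · rw [Measure.map_map (by fun_prop) hg]
    have : (fun (x : Fin (n + 1) → Pt d) => (x k.castSucc, x (Fin.last n))) ∘ g =
        (fun p : (Fin n → Pt d) × Pt d => (p.1 k, p.2)) := by
      ext p <;> simp [g]
    rw [this, hpair]

lemma young {d : ℕ} (a b : Pt d) (c : ℝ) (hc : 0 < c) :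
    ‖a + b‖ ^ 2 ≤ (1 + c⁻¹) * ‖a‖ ^ 2 + (1 + c) * ‖b‖ ^ 2 := by
  have h1 : ‖a + b‖ ^ 2 ≤ (‖a‖ + ‖b‖) ^ 2 := by
    gcongr; exact norm_add_le a b
  have h2 : 0 ≤ c⁻¹ * (‖a‖ - c * ‖b‖) ^ 2 := by positivity
  have h3 : c⁻¹ * (‖a‖ - c * ‖b‖) ^ 2 = c⁻¹ * ‖a‖ ^ 2 - 2 * ‖a‖ * ‖b‖ + c * ‖b‖ ^ 2 := by
    field_simp
    ring
  nlinarith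

/-- The pointwise estimate with constants depending on `n`. -/
lemma consts {d n : ℕ} (hn : 1 ≤ n) : ∃ A B : ℝ, 0 ≤ A ∧ 0 ≤ B ∧
    (∀ (l : Fin n → ℝ) (_ : 0 < ∑ j, l j) (x : Fin n → Pt d) (k : Fin n) (y : Pt d),
      ‖(∑ i, (l i / ∑ j, l j) • x i) - y‖ ^ 2 ≤
        A * ‖x k - ∑ i, (l i / ∑ j, l j) • x i‖ ^ 2 + B * ‖x k - y‖ ^ 2) ∧
    ENNReal.ofReal (1 + (1 + A) / n) * ENNReal.ofReal ((2 * (n : ℝ) ^ 2 - 5) / 3) ≤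
      ENNReal.ofReal ((2 * ((n + 1 : ℕ) : ℝ) ^ 2 - 5) / 3) ∧
    B ≤ (2 * ((n + 1 : ℕ) : ℝ) ^ 2 - 5) / 3 := by
  rcases Nat.lt_or_ge 1 n with h | h
  · have hn2 : (2 : ℝ) ≤ n := by exact_mod_cast h
    have hn0 : (0 : ℝ) < n := by linarith
    refine ⟨1 + (n : ℝ)⁻¹, 1 + n, by positivity, by positivity, ?_, ?_, ?_⟩
    · intro l _ x k y
      have := young ((∑ i, (l i / ∑ j, l j) • x i) - x k) (x k - y) n hn0
      rw [sub_add_sub_cancel, norm_sub_rev _ (x k)] at this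
      exact this
    · rw [← ENNReal.ofReal_mul (by positivity)]
      refine ENNReal.ofReal_le_ofReal ?_
      have : (1 + (1 + (1 + (n : ℝ)⁻¹)) / n) = (n ^ 2 + 2 * n + 1) / n ^ 2 := by
        field_simp; ring
      rw [this, div_mul_div_comm, div_le_div_iff₀ (by positivity) (by norm_num)]
      push_cast
      nlinarith
    · push_cast
      nlinarith
  · obtain rfl : n = 1 := by omega
    refine ⟨0, 1, le_rfl, zero_le_one, ?_, ?_, ?_⟩
    · intro l hS x k y
      have hk : k = 0 := Subsingleton.elim _ _
      subst hk
      simp only [Fin.sum_univ_one] at hS ⊢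
      rw [div_self hS.ne']
      simp
    · have : ENNReal.ofReal ((2 * ((1 : ℕ) : ℝ) ^ 2 - 5) / 3) = 0 :=
        ENNReal.ofReal_eq_zero.2 (by norm_num)
      rw [this]; simp
    · norm_num

lemma step {d n : ℕ} (hn : 1 ≤ n) (l : Fin (n + 1) → ℝ) (hl : ∀ i, 0 < l i)
    (hmono : ∀ i j, i ≤ j → l j ≤ l i)
    (ρ next : Measure (Fin (n + 1) → Pt d)) [IsProbabilityMeasure ρ]
    (prev : Measure (Fin n → Pt d)) [IsProbabilityMeasure prev]
    (hmarg : ∀ k : Fin n, prev.map (fun x => x k) = ρ.map (fun x => x k.castSucc))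
    (hstep : GreedyStep (fun i : Fin n => l i.castSucc) prev
      (ρ.map (fun x => x (Fin.last n))) next)
    (ih : MOT (fun i : Fin n => l i.castSucc) prev ≤
      ENNReal.ofReal ((2 * (n : ℝ) ^ 2 - 5) / 3) *
        MOT (fun i : Fin n => l i.castSucc) (ρ.map (fun x (i : Fin n) => x i.castSucc))) :
    MOT l next ≤ ENNReal.ofReal ((2 * ((n + 1 : ℕ) : ℝ) ^ 2 - 5) / 3) * MOT l ρ := by
  obtain ⟨⟨_, hproj, hlast⟩, hmin⟩ := hstep
  obtain ⟨A, B, hA, hB, hpt, hC, hBC⟩ := consts (d := d) hn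
  set l' : Fin n → ℝ := fun i => l i.castSucc with hl'
  have hl'0 : ∀ i, 0 < l' i := fun i => hl _
  set S := ∑ j, l' j with hSdef
  set a := l (Fin.last n) with ha
  have ha0 : 0 < a := hl _
  have hn0 : (0 : ℝ) < n := by exact_mod_cast hn
  have hna : n * a ≤ S := by
    have : ∑ _j : Fin n, a ≤ S := Finset.sum_le_sum fun i _ => hmono _ _ (Fin.le_last _)
    simpa using this
  have hS : 0 < S := lt_of_lt_of_le (by positivity) hna
  -- mean and weighted variance
  let m : (Fin n → Pt d) → Pt d := fun x => ∑ i, (l' i / S) • x i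
  have hm : Measurable m := by fun_prop
  let W : ENNReal := ∑ k, ENNReal.ofReal (l' k) *
    ∫⁻ x, ENNReal.ofReal (‖x k - m x‖ ^ 2) ∂prev
  have hW : W = ∫⁻ x, ENNReal.ofReal (∑ k, l' k * ‖x k - m x‖ ^ 2) ∂prev := by
    have : ∀ x : Fin n → Pt d, ENNReal.ofReal (∑ k, l' k * ‖x k - m x‖ ^ 2) =
        ∑ k, ENNReal.ofReal (l' k) * ENNReal.ofReal (‖x k - m x‖ ^ 2) := by
      intro x
      rw [ENNReal.ofReal_sum_of_nonneg fun k _ => mul_nonneg (hl'0 k).le (by positivity)]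
      exact Finset.sum_congr rfl fun k _ => ENNReal.ofReal_mul (hl'0 k).le
    simp only [this]
    rw [lintegral_finsetSum _ (fun k _ => by fun_prop)]
    refine Finset.sum_congr rfl fun k _ => ?_
    rw [lintegral_const_mul _ (by fun_prop)]
  have hMprev : MOT l' prev = ENNReal.ofReal S * W := by
    rw [hW, ← lintegral_const_mul _ (by fun_prop)]
    unfold MOT
    refine lintegral_congr fun x => ?_
    rw [← ENNReal.ofReal_mul hS.le, ← pair_identity l' hS.ne' x]
    have hnn : ∀ s t, 0 ≤ (if s < t then l' s * l' t * ‖x s - x t‖ ^ 2 else 0) := by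
      intro s t
      split_ifs
      · have := hl'0 s; have := hl'0 t; positivity
      · exact le_rfl
    rw [ENNReal.ofReal_sum_of_nonneg fun s _ => Finset.sum_nonneg fun t _ => hnn s t]
    refine Finset.sum_congr rfl fun s _ => ?_
    rw [ENNReal.ofReal_sum_of_nonneg fun t _ => hnn s t]
    refine Finset.sum_congr rfl fun t _ => ?_
    split_ifs <;> simp
  let G := greedyCost l' next
  have hsum : ∑ k : Fin n, ENNReal.ofReal (l k.castSucc) *
        ∫⁻ x, ENNReal.ofReal (‖x k.castSucc - x (Fin.last n)‖ ^ 2) ∂next =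
      ENNReal.ofReal S * G + W := by
    have hG : G = ∫⁻ x, ENNReal.ofReal (‖m (fun i => x i.castSucc) - x (Fin.last n)‖ ^ 2) ∂next :=
      rfl
    rw [hW, ← hproj, lintegral_map (by fun_prop) measurable_proj, hG,
      ← lintegral_const_mul _ (by fun_prop), ← lintegral_add_right _ (by fun_prop)]
    have : ∀ k : Fin n, ENNReal.ofReal (l k.castSucc) *
        ∫⁻ x, ENNReal.ofReal (‖x k.castSucc - x (Fin.last n)‖ ^ 2) ∂next =
        ∫⁻ x, ENNReal.ofReal (l' k * ‖x k.castSucc - x (Fin.last n)‖ ^ 2) ∂next := by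
      intro k
      rw [← lintegral_const_mul _ (by fun_prop)]
      exact lintegral_congr fun x => (ENNReal.ofReal_mul (hl'0 k).le).symm
    simp only [this]
    rw [← lintegral_finsetSum _ (fun k _ => by fun_prop)]
    refine lintegral_congr fun x => ?_
    have hnn : ∀ k, 0 ≤ l' k := fun k => (hl'0 k).le
    rw [← ENNReal.ofReal_sum_of_nonneg fun k _ => mul_nonneg (hnn k) (by positivity),
      ← ENNReal.ofReal_mul hS.le,
      ← ENNReal.ofReal_add (by positivity)
        (Finset.sum_nonneg fun k _ => mul_nonneg (hnn k) (by positivity))]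
    congr 1
    exact bary_identity l' hS.ne' (fun i => x i.castSucc) (x (Fin.last n))
  let D : Fin n → ENNReal := fun k =>
    ∫⁻ x, ENNReal.ofReal (‖x k.castSucc - x (Fin.last n)‖ ^ 2) ∂ρ
  have hGk : ∀ k : Fin n, G ≤ ENNReal.ofReal A * (∫⁻ x, ENNReal.ofReal (‖x k - m x‖ ^ 2) ∂prev) +
      ENNReal.ofReal B * D k := by
    intro k
    let ν : Measure (Pt d × Pt d) := ρ.map (fun x => (x k.castSucc, x (Fin.last n)))
    have : IsProbabilityMeasure ν := Measure.isProbabilityMeasure_map (by fun_prop)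
    have hfst : ν.fst = ρ.map (fun x => x k.castSucc) := by
      rw [Measure.fst, Measure.map_map (by fun_prop) (by fun_prop)]; rfl
    have hsnd : ν.snd = ρ.map (fun x => x (Fin.last n)) := by
      rw [Measure.snd, Measure.map_map (by fun_prop) (by fun_prop)]; rfl
    obtain ⟨Q, hQ, hQν⟩ := competitor prev ν k (by rw [hmarg, hfst])
    rw [hsnd] at hQ
    refine (hmin Q hQ).trans ?_
    have hD : D k = ∫⁻ x, ENNReal.ofReal (‖x k.castSucc - x (Fin.last n)‖ ^ 2) ∂Q := by
      have h1 : D k = ∫⁻ p, ENNReal.ofReal (‖p.1 - p.2‖ ^ 2) ∂ν := by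
        rw [lintegral_map (by fun_prop) (by fun_prop)]
      rw [h1, ← hQν, lintegral_map (by fun_prop) (by fun_prop)]
    rw [hD]
    have h2 : ∫⁻ x, ENNReal.ofReal (‖x k - m x‖ ^ 2) ∂prev =
        ∫⁻ x, ENNReal.ofReal (‖x k.castSucc - m (fun i => x i.castSucc)‖ ^ 2) ∂Q := by
      rw [← hQ.2.1, lintegral_map (by fun_prop) measurable_proj]
    rw [h2, ← lintegral_const_mul _ (by fun_prop), ← lintegral_const_mul _ (by fun_prop),
      ← lintegral_add_right _ (by fun_prop)]
    refine lintegral_mono fun x => ?_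
    simp only
    rw [← ENNReal.ofReal_mul hA, ← ENNReal.ofReal_mul hB,
      ← ENNReal.ofReal_add (by positivity) (by positivity)]
    exact ENNReal.ofReal_le_ofReal (hpt l' hS (fun i => x i.castSucc) k (x (Fin.last n)))
  let T : ENNReal := ∑ k, ENNReal.ofReal (l' k) * D k
  have hSG : ENNReal.ofReal S * G ≤ ENNReal.ofReal A * W + ENNReal.ofReal B * T := by
    rw [hSdef, ENNReal.ofReal_sum_of_nonneg fun k _ => (hl'0 k).le, Finset.sum_mul]
    refine (Finset.sum_le_sum fun k _ => mul_le_mul_right (hGk k) _).trans (le_of_eq ?_)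
    simp only [W, T, Finset.mul_sum]
    rw [← Finset.sum_add_distrib]
    exact Finset.sum_congr rfl fun k _ => by ring
  have hMρ := MOT_succ l hl ρ
  change _ = MOT l' _ + ENNReal.ofReal a * T at hMρ
  have hMn := MOT_succ l hl next
  rw [hproj, hsum] at hMn
  change _ = MOT l' prev + ENNReal.ofReal a * _ at hMn
  rw [hMn, hMρ]
  set C1 := ENNReal.ofReal ((2 * ((n + 1 : ℕ) : ℝ) ^ 2 - 5) / 3)
  have haS : ENNReal.ofReal a * ENNReal.ofReal (1 + A) * W ≤
      ENNReal.ofReal ((1 + A) / n) * (ENNReal.ofReal S * W) := by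
    rw [← ENNReal.ofReal_mul ha0.le, ← mul_assoc, ← ENNReal.ofReal_mul (by positivity)]
    refine mul_le_mul_left (ENNReal.ofReal_le_ofReal ?_) _
    rw [div_mul_eq_mul_div, le_div_iff₀ hn0]
    nlinarith
  calc MOT l' prev + ENNReal.ofReal a * (ENNReal.ofReal S * G + W)
      ≤ MOT l' prev + ENNReal.ofReal a * ((ENNReal.ofReal A * W + ENNReal.ofReal B * T) + W) := by
        gcongr
    _ = MOT l' prev + ENNReal.ofReal a * ENNReal.ofReal (1 + A) * W +
          ENNReal.ofReal B * (ENNReal.ofReal a * T) := by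
        rw [ENNReal.ofReal_add zero_le_one hA, ENNReal.ofReal_one]; ring
    _ ≤ MOT l' prev + ENNReal.ofReal ((1 + A) / n) * MOT l' prev +
          C1 * (ENNReal.ofReal a * T) := by
        rw [hMprev]
        exact add_le_add (add_le_add le_rfl haS)
          (mul_le_mul_left (ENNReal.ofReal_le_ofReal hBC) _)
    _ = ENNReal.ofReal (1 + (1 + A) / n) * MOT l' prev + C1 * (ENNReal.ofReal a * T) := by
        rw [ENNReal.ofReal_add zero_le_one (by positivity), ENNReal.ofReal_one]; ring
    _ ≤ C1 * MOT l' (ρ.map (fun x (i : Fin n) => x i.castSucc)) +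
          C1 * (ENNReal.ofReal a * T) := by
        refine add_le_add ?_ le_rfl
        refine (mul_le_mul_right ih _).trans ?_
        rw [← mul_assoc]
        exact mul_le_mul_left hC _
    _ = _ := by ring

/-- Assume `λ₁ ≥ … ≥ λ_N`. If `π̃ = π̃^{(N)}` is obtained by the greedy
iteration, then `Φ(π̃) ≤ ((2N² − 5)/3) Φ(π̂)` for every optimal MOT plan `π̂`. -/
theorem stmt15 {d N : ℕ} (hN : 0 < N) (μ : Fin N → Measure (Pt d))
    (hμ : ∀ i, IsProbabilityMeasure (μ i) ∧ FinitelySupported (μ i))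
    (l : Fin N → ℝ) (hl : InSimplex l)
    (hmono : ∀ i j : Fin N, i ≤ j → l j ≤ l i)
    (P : (r : ℕ) → Measure (Fin r → Pt d))
    (hP1 : P 1 = (μ ⟨0, hN⟩).map (fun y => fun _ : Fin 1 => y))
    (hstep : ∀ r : ℕ, 1 ≤ r → ∀ hr : r < N,
      GreedyStep (fun i : Fin r => l (Fin.castLE (le_of_lt hr) i))
        (P r) (μ ⟨r, hr⟩) (P (r + 1))) :
    ∀ pihat, IsPlan μ pihat → (∀ π, IsPlan μ π → MOT l pihat ≤ MOT l π) →
      MOT l (P N) ≤ ENNReal.ofReal ((2 * (N : ℝ) ^ 2 - 5) / 3) * MOT l pihat := by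
  intro pihat hpi _
  obtain ⟨hprob, hmar⟩ := hpi
  have key : ∀ r : ℕ, 1 ≤ r → ∀ hr : r ≤ N, IsProbabilityMeasure (P r) ∧
      (∀ k : Fin r, (P r).map (fun x => x k) = μ (Fin.castLE hr k)) ∧
      MOT (fun i : Fin r => l (Fin.castLE hr i)) (P r) ≤
        ENNReal.ofReal ((2 * (r : ℝ) ^ 2 - 5) / 3) *
          MOT (fun i : Fin r => l (Fin.castLE hr i))
            (pihat.map (fun x (i : Fin r) => x (Fin.castLE hr i))) := by
    intro r h1
    induction r, h1 using Nat.le_induction with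
    | base =>
      intro hr
      have := (hμ ⟨0, hN⟩).1
      refine ⟨?_, ?_, ?_⟩
      · rw [hP1]
        exact Measure.isProbabilityMeasure_map (by fun_prop)
      · intro k
        have hk : k = 0 := Subsingleton.elim _ _
        subst hk
        rw [hP1, Measure.map_map (by fun_prop) (by fun_prop)]
        exact Measure.map_id
      · have : MOT (fun i : Fin 1 => l (Fin.castLE hr i)) (P 1) = 0 := by
          rw [MOT_eq]; simp
        rw [this]
        exact zero_le
    | succ n hn ih =>
      intro hr
      have hr' : n < N := hr
      obtain ⟨hp, hm, hle⟩ := ih hr'.le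
      have hst := hstep n hn hr'
      have hpn : IsProbabilityMeasure (P (n + 1)) := hst.1.1
      have hproj := hst.1.2.1
      have hlast := hst.1.2.2
      refine ⟨hpn, ?_, ?_⟩
      · intro k
        refine Fin.lastCases ?_ (fun j => ?_) k
        · exact hlast
        · have := hm j
          rw [← hproj, Measure.map_map (by fun_prop) measurable_proj] at this
          exact this
      · let ρ : Measure (Fin (n + 1) → Pt d) :=
          pihat.map (fun x (i : Fin (n + 1)) => x (Fin.castLE hr i))
        have hρ : IsProbabilityMeasure ρ :=
          Measure.isProbabilityMeasure_map
            (measurable_pi_iff.2 fun i => measurable_pi_apply _).aemeasurable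
        have hρm : ∀ k : Fin (n + 1), ρ.map (fun x => x k) = μ (Fin.castLE hr k) := by
          intro k
          rw [← hmar, Measure.map_map (by fun_prop) (by fun_prop)]
          rfl
        have hρi : ρ.map (fun x (i : Fin n) => x i.castSucc) =
            pihat.map (fun x (i : Fin n) => x (Fin.castLE hr'.le i)) := by
          rw [Measure.map_map measurable_proj (by fun_prop)]
          rfl
        refine step hn (fun i => l (Fin.castLE hr i)) (fun i => hl.1 _)
          (fun i j hij => hmono _ _ (by simpa using hij)) ρ (P (n + 1)) (P n) ?_ ?_ ?_
        · intro k
          rw [hm, hρm]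
          rfl
        · rw [hρm]
          exact hst
        · rw [hρi]
          exact hle
  have h := (key N hN le_rfl).2.2
  have hid : (fun (x : Fin N → Pt d) (i : Fin N) => x (Fin.castLE le_rfl i)) = id := rfl
  rw [hid, Measure.map_id] at h
  exact h
end
end

section
/- Let λ_i = 1/N for all i, with N ≥ 2. For each permutation σ of {1,…,N}, let π̃_σ be any plan obtained by running the greedy iteration on the reordered measures μ^{σ(1)},…,μ^{σ(N)} (π̃^{(1)} = μ^{σ(1)} and each π̃^{(r)} minimizes ∫ ‖(1/(r−1)) Σ_{i<r} x_i − x_r‖² dπ over measures on (ℝ^d)^r with first-(r−1)-coordinates projection π̃^{(r−1)} and r-th marginal μ^{σ(r)}), and let Φ(π̃_σ) denote its MOT cost. Then the average over all N! permutations satisfies (1/N!) Σ_σ Φ(π̃_σ) ≤ (1/12)(11N − 4 − 6/(N−1)) · Φ(π̂) for every optimal plan π̂, and moreover (1/12)(11N − 4 − 6/(N−1)) < N. -/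
open MeasureTheory
open scoped ENNReal

noncomputable section

lemma sum_symm_half {M : Type*} [AddCommMonoid M] {N : ℕ} (f : Fin N → Fin N → M)
    (hs : ∀ s t, f s t = f t s) (h0 : ∀ s, f s s = 0) :
    ∑ s, ∑ t, f s t = (∑ s, ∑ t, if s < t then f s t else 0)
      + (∑ s, ∑ t, if s < t then f s t else 0) := by
  have h : ∀ s t, f s t = (if s < t then f s t else 0) + (if t < s then f t s else 0) := by
    intro s t
    rcases lt_trichotomy s t with h | h | h
    · simp [h, h.le, not_lt_of_gt h]
    · subst h; simp [h0]
    · simp [h, not_lt_of_gt h, hs s t]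
  calc ∑ s, ∑ t, f s t
      = ∑ s, ∑ t, ((if s < t then f s t else 0) + (if t < s then f t s else 0)) :=
        Finset.sum_congr rfl fun s _ => Finset.sum_congr rfl fun t _ => h s t
    _ = _ := by
        simp only [Finset.sum_add_distrib]
        congr 1
        rw [Finset.sum_comm]

/-- mean of `r` points -/
def mean17 {d r : ℕ} (x : Fin r → Pt d) : Pt d := (1 / (r : ℝ)) • ∑ i, x i

lemma var_eq {d r : ℕ} (hr : 1 ≤ r) (x : Fin r → Pt d) :
    ∑ i, ‖mean17 x - x i‖ ^ 2 = ∑ i, ‖x i‖ ^ 2 - (1 / (r : ℝ)) * ‖∑ i, x i‖ ^ 2 := by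
  have hr' : (r : ℝ) ≠ 0 := by positivity
  have : ∀ i, ‖mean17 x - x i‖ ^ 2
      = ‖mean17 x‖ ^ 2 - 2 * inner ℝ (mean17 x) (x i) + ‖x i‖ ^ 2 := fun i =>
    norm_sub_sq_real _ _
  simp only [this, Finset.sum_add_distrib, Finset.sum_sub_distrib, ← Finset.mul_sum, ← inner_sum]
  simp only [mean17, inner_smul_left, norm_smul, real_inner_self_eq_norm_sq]
  simp
  field_simp
  ring

lemma pair_eq {d r : ℕ} (x : Fin r → Pt d) :
    (∑ s, ∑ t, if s < t then ‖x s - x t‖ ^ 2 else 0)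
      = r * ∑ i, ‖x i‖ ^ 2 - ‖∑ i, x i‖ ^ 2 := by
  have h := sum_symm_half (fun s t => ‖x s - x t‖ ^ 2) (fun s t => by rw [norm_sub_rev])
    (fun s => by simp)
  have h2 : ∑ s, ∑ t, ‖x s - x t‖ ^ 2 = 2 * (r * ∑ i, ‖x i‖ ^ 2 - ‖∑ i, x i‖ ^ 2) := by
    simp only [norm_sub_sq_real, Finset.sum_add_distrib, Finset.sum_sub_distrib,
      ← Finset.mul_sum, ← inner_sum, ← sum_inner, real_inner_self_eq_norm_sq]
    simp [← Finset.mul_sum]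
    ring
  linarith

lemma var_succ {d r : ℕ} (hr : 1 ≤ r) (x : Fin (r + 1) → Pt d) :
    ((r : ℝ) + 1) * ∑ i, ‖mean17 x - x i‖ ^ 2
      = (r + 1) * ∑ i : Fin r, ‖mean17 (fun k : Fin r => x k.castSucc) - x i.castSucc‖ ^ 2
        + r * ‖mean17 (fun k : Fin r => x k.castSucc) - x (Fin.last r)‖ ^ 2 := by
  have hr' : (r : ℝ) ≠ 0 := by positivity
  rw [var_eq (by omega), var_eq hr (fun k : Fin r => x k.castSucc), norm_sub_sq_real,
    Fin.sum_univ_castSucc, Fin.sum_univ_castSucc, norm_add_sq_real]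
  simp only [mean17, inner_smul_left, norm_smul, real_inner_self_eq_norm_sq]
  simp
  field_simp
  ring

/-- variance functional in ENNReal -/
def S17 {d r : ℕ} (π : Measure (Fin r → Pt d)) : ℝ≥0∞ :=
  ∫⁻ x, ∑ i, ENNReal.ofReal (‖mean17 x - x i‖ ^ 2) ∂π

@[fun_prop]
lemma mean17_meas {d r : ℕ} : Measurable (mean17 : (Fin r → Pt d) → Pt d) := by
  unfold mean17; fun_prop

lemma MOT_eq_s17 {d N : ℕ} (hN : 1 ≤ N) (π : Measure (Fin N → Pt d)) :
    (N : ℝ≥0∞) * MOT (fun _ => (1 : ℝ) / N) π = S17 π := by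
  unfold MOT S17
  rw [← lintegral_const_mul _ (by
    refine Finset.measurable_sum _ fun s _ => Finset.measurable_sum _ fun t _ => ?_
    split_ifs <;> fun_prop)]
  congr 1
  funext x
  have hr' : (N : ℝ) ≠ 0 := by positivity
  have e : ∀ s t : Fin N, (if s < t then
      ENNReal.ofReal ((1 : ℝ) / N * (1 / N) * ‖x s - x t‖ ^ 2) else 0)
      = ENNReal.ofReal (if s < t then (1 : ℝ) / N * (1 / N) * ‖x s - x t‖ ^ 2 else 0) := by
    intro s t; split_ifs <;> simp
  have e2 : ∀ s t : Fin N, (if s < t then (1 : ℝ) / N * (1 / N) * ‖x s - x t‖ ^ 2 else 0)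
      = (1 : ℝ) / N * (1 / N) * (if s < t then ‖x s - x t‖ ^ 2 else 0) := by
    intro s t; split_ifs <;> simp
  have nn : ∀ s t : Fin N, 0 ≤ (if s < t then (1 : ℝ) / N * (1 / N) * ‖x s - x t‖ ^ 2 else 0) := by
    intro s t; split_ifs <;> positivity
  simp only [e]
  rw [← ENNReal.ofReal_sum_of_nonneg (fun i _ => by positivity), var_eq hN]
  simp_rw [← ENNReal.ofReal_sum_of_nonneg (fun t _ => nn _ t)]
  rw [← ENNReal.ofReal_sum_of_nonneg (fun i _ => Finset.sum_nonneg fun t _ => nn i t)]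
  rw [← ENNReal.ofReal_natCast, ← ENNReal.ofReal_mul (by positivity)]
  simp only [e2, ← Finset.mul_sum, pair_eq]
  congr 1
  field_simp

lemma S_succ {d r : ℕ} (hr : 1 ≤ r) (c : ℝ) (hc : c ≠ 0) (prev : Measure (Fin r → Pt d))
    (μr : Measure (Pt d)) (Q : Measure (Fin (r + 1) → Pt d)) (h : StepAdmissible prev μr Q) :
    ((r : ℝ≥0∞) + 1) * S17 Q = (r + 1) * S17 prev + r * greedyCost (fun _ => c) Q := by
  obtain ⟨h1, h2, h3⟩ := h
  have hr' : (r : ℝ) ≠ 0 := by positivity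
  rw [← h2]
  unfold S17 greedyCost
  rw [lintegral_map (by fun_prop) (by fun_prop), ← lintegral_const_mul _ (by fun_prop),
    ← lintegral_const_mul _ (by fun_prop), ← lintegral_const_mul _ (by fun_prop),
    ← lintegral_add_left (by fun_prop)]
  congr 1
  funext x
  have e : ∑ i : Fin r, (c / ∑ j : Fin r, c) • x i.castSucc
      = mean17 (fun k : Fin r => x k.castSucc) := by
    rw [← Finset.smul_sum, mean17]
    congr 1
    simp
    field_simp
  rw [e]
  have e1 : ((r : ℝ≥0∞) + 1) = ENNReal.ofReal ((r : ℝ) + 1) := by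
    rw [ENNReal.ofReal_add (by positivity) (by positivity)]; simp
  have e2 : (r : ℝ≥0∞) = ENNReal.ofReal (r : ℝ) := by simp
  rw [e1, e2, ← ENNReal.ofReal_sum_of_nonneg (fun i _ => by positivity),
    ← ENNReal.ofReal_sum_of_nonneg (fun i _ => by positivity),
    ← ENNReal.ofReal_mul (by positivity), ← ENNReal.ofReal_mul (by positivity),
    ← ENNReal.ofReal_mul (by positivity), ← ENNReal.ofReal_add (by positivity) (by positivity),
    var_succ hr]

open ProbabilityTheory in
lemma glue {d r : ℕ} (prev : Measure (Fin r → Pt d)) [IsProbabilityMeasure prev] (j : Fin r)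
    (ρ : Measure (Pt d × Pt d)) [IsProbabilityMeasure ρ]
    (h : prev.map (fun x => x j) = ρ.fst) :
    ∃ Q : Measure (Fin (r + 1) → Pt d), StepAdmissible prev ρ.snd Q ∧
      ∀ f : Pt d × Pt d → ℝ≥0∞, Measurable f →
        ∫⁻ x, f (x j.castSucc, x (Fin.last r)) ∂Q = ∫⁻ p, f p ∂ρ := by
  let κ : Kernel (Fin r → Pt d) (Pt d) := ρ.condKernel.comap (fun x => x j) (by fun_prop)
  let F : (Fin r → Pt d) × Pt d → (Fin (r + 1) → Pt d) := fun p => Fin.snoc p.1 p.2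
  have hF : Measurable F := by
    refine measurable_pi_lambda _ fun i => ?_
    refine Fin.lastCases ?_ (fun i => ?_) i
    · simp only [F, Fin.snoc_last]; fun_prop
    · simp only [F, Fin.snoc_castSucc]; fun_prop
  have key : ∀ f : Pt d × Pt d → ℝ≥0∞, Measurable f →
        ∫⁻ x, f (x j.castSucc, x (Fin.last r)) ∂((prev ⊗ₘ κ).map F) = ∫⁻ p, f p ∂ρ := by
    intro f hf
    rw [lintegral_map (by fun_prop) hF]
    simp only [F, Fin.snoc_last, Fin.snoc_castSucc]
    rw [Measure.lintegral_compProd (by fun_prop)]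
    simp only [κ, Kernel.comap_apply]
    conv_rhs => rw [← ρ.disintegrate ρ.condKernel, Measure.lintegral_compProd hf, ← h]
    rw [lintegral_map (Measurable.lintegral_kernel_prod_right' hf) (by fun_prop)]
  refine ⟨(prev ⊗ₘ κ).map F, ⟨Measure.isProbabilityMeasure_map hF.aemeasurable, ?_, ?_⟩, key⟩
  · rw [Measure.map_map (by fun_prop) hF]
    have : ((fun x (i : Fin r) => x i.castSucc) ∘ F : (Fin r → Pt d) × Pt d → _) = Prod.fst := by
      funext p; simp [F]
    rw [this]
    exact Measure.fst_compProd prev κ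
  · ext s hs
    have := key (fun p => s.indicator 1 p.2) (by
      exact (measurable_one.indicator hs).comp measurable_snd)
    rw [Measure.map_apply (by fun_prop) hs, Measure.snd_apply hs]
    have g1 : ∀ (A : Set (Fin (r+1) → Pt d)), A = (fun x => x (Fin.last r)) ⁻¹' s → 
      ((prev ⊗ₘ κ).map F) A = ∫⁻ x, s.indicator 1 (x (Fin.last r)) ∂((prev ⊗ₘ κ).map F) := by
      rintro A rfl
      rw [← lintegral_indicator_one (hs.preimage (by fun_prop))]
      rfl
    rw [g1 _ rfl, this, ← lintegral_indicator_one (hs.preimage (by fun_prop))]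
    rfl

lemma greedyCost_eq {d r : ℕ} (hr : 1 ≤ r) (c : ℝ) (hc : c ≠ 0)
    (Q : Measure (Fin (r + 1) → Pt d)) :
    greedyCost (fun _ => c) Q = ∫⁻ x, ENNReal.ofReal
      (‖mean17 (fun k : Fin r => x k.castSucc) - x (Fin.last r)‖ ^ 2) ∂Q := by
  have hr' : (r : ℝ) ≠ 0 := by positivity
  unfold greedyCost
  congr 1
  funext x
  have e : ∑ i : Fin r, (c / ∑ j : Fin r, c) • x i.castSucc
      = mean17 (fun k : Fin r => x k.castSucc) := by
    rw [← Finset.smul_sum, mean17]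
    congr 1
    simp
    field_simp
  rw [e]

lemma step_bound {d r : ℕ} (hr : 1 ≤ r) (c : ℝ) (hc : c ≠ 0) (prev : Measure (Fin r → Pt d))
    [IsProbabilityMeasure prev] (μr : Measure (Pt d)) (next : Measure (Fin (r + 1) → Pt d))
    (h : GreedyStep (fun _ => c) prev μr next) (j : Fin r)
    (ρ : Measure (Pt d × Pt d)) [IsProbabilityMeasure ρ]
    (h1 : prev.map (fun x => x j) = ρ.fst) (h2 : ρ.snd = μr) :
    greedyCost (fun _ => c) next ≤ 2 * ∫⁻ x, ENNReal.ofReal (‖mean17 x - x j‖ ^ 2) ∂prev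
      + 2 * ∫⁻ p, ENNReal.ofReal (‖p.1 - p.2‖ ^ 2) ∂ρ := by
  obtain ⟨Q, hQ, hf⟩ := glue prev j ρ h1
  rw [h2] at hQ
  refine (h.2 Q hQ).trans ?_
  rw [greedyCost_eq hr c hc, ← hf _ (by fun_prop), ← hQ.2.1,
    lintegral_map (by fun_prop) (by fun_prop), ← lintegral_const_mul _ (by fun_prop),
    ← lintegral_const_mul _ (by fun_prop), ← lintegral_add_left (by fun_prop)]
  refine lintegral_mono fun x => ?_
  have e2 : ∀ y : ℝ, 2 * ENNReal.ofReal y = ENNReal.ofReal (2 * y) := fun y => by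
    rw [ENNReal.ofReal_mul (by positivity)]; simp
  dsimp only
  rw [e2, e2, ← ENNReal.ofReal_add (by positivity) (by positivity)]
  refine ENNReal.ofReal_le_ofReal ?_
  set a := mean17 fun k : Fin r => x k.castSucc
  have := norm_sub_le_norm_sub_add_norm_sub a (x j.castSucc) (x (Fin.last r))
  have h0 := norm_nonneg (a - x (Fin.last r))
  nlinarith [sq_nonneg (‖a - x j.castSucc‖ - ‖x j.castSucc - x (Fin.last r)‖)]

lemma step_bound_one {d : ℕ} (c : ℝ) (hc : c ≠ 0) (prev : Measure (Fin 1 → Pt d))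
    [IsProbabilityMeasure prev] (μr : Measure (Pt d)) (next : Measure (Fin (1 + 1) → Pt d))
    (h : GreedyStep (fun _ => c) prev μr next)
    (ρ : Measure (Pt d × Pt d)) [IsProbabilityMeasure ρ]
    (h1 : prev.map (fun x => x 0) = ρ.fst) (h2 : ρ.snd = μr) :
    greedyCost (fun _ => c) next ≤ ∫⁻ p, ENNReal.ofReal (‖p.1 - p.2‖ ^ 2) ∂ρ := by
  obtain ⟨Q, hQ, hf⟩ := glue prev 0 ρ h1
  rw [h2] at hQ
  refine (h.2 Q hQ).trans ?_
  rw [greedyCost_eq le_rfl c hc, ← hf _ (by fun_prop)]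
  refine lintegral_mono fun x => ?_
  simp [mean17]

lemma S_one {d : ℕ} (π : Measure (Fin 1 → Pt d)) : S17 π = 0 := by
  simp [S17, mean17]

/-- Expected squared distance of two coordinates -/
def b17 {d N : ℕ} (π : Measure (Fin N → Pt d)) (s t : Fin N) : ℝ≥0∞ :=
  ∫⁻ x, ENNReal.ofReal (‖x s - x t‖ ^ 2) ∂π

lemma b17_symm {d N : ℕ} (π : Measure (Fin N → Pt d)) (s t : Fin N) :
    b17 π s t = b17 π t s := by
  simp only [b17, norm_sub_rev]

lemma b17_self {d N : ℕ} (π : Measure (Fin N → Pt d)) (s : Fin N) : b17 π s s = 0 := by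
  simp [b17]

lemma MOT_b {d N : ℕ} (hN : 1 ≤ N) (π : Measure (Fin N → Pt d)) :
    ∑ s, ∑ t, b17 π s t = 2 * ((N : ℝ≥0∞) * N * MOT (fun _ => (1 : ℝ) / N) π) := by
  have hr' : (N : ℝ) ≠ 0 := by positivity
  rw [sum_symm_half _ (b17_symm π) (b17_self π), two_mul]
  have : (∑ s, ∑ t, if s < t then b17 π s t else 0)
      = (N : ℝ≥0∞) * N * MOT (fun _ => (1 : ℝ) / N) π := by
    unfold MOT
    have hm : ∀ s t : Fin N, Measurable fun x : Fin N → Pt d => (if s < t then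
        ENNReal.ofReal ((1 : ℝ) / N * (1 / N) * ‖x s - x t‖ ^ 2) else 0) := by
      intro s t; split_ifs <;> fun_prop
    rw [lintegral_finsetSum _ fun s _ => Finset.measurable_sum _ fun t _ => hm s t,
      Finset.mul_sum]
    refine Finset.sum_congr rfl fun s _ => ?_
    rw [lintegral_finsetSum _ fun t _ => hm s t, Finset.mul_sum]
    refine Finset.sum_congr rfl fun t _ => ?_
    split_ifs
    · rw [b17, ← lintegral_const_mul _ (by fun_prop)]
      congr 1
      funext x
      rw [← ENNReal.ofReal_natCast, ← ENNReal.ofReal_mul (by positivity),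
        ← ENNReal.ofReal_mul (by positivity)]
      congr 1
      field_simp
    · simp
  rw [this]

lemma perm_pair {N : ℕ} (f : Fin N → Fin N → ℝ≥0∞) (i j k l : Fin N) (h1 : i ≠ j) (h2 : k ≠ l) :
    ∑ σ : Equiv.Perm (Fin N), f (σ i) (σ j) = ∑ σ : Equiv.Perm (Fin N), f (σ k) (σ l) := by
  obtain ⟨τ, hk, hl⟩ : ∃ τ : Equiv.Perm (Fin N), τ k = i ∧ τ l = j := by
    refine ⟨Equiv.swap j (Equiv.swap i k l) * Equiv.swap i k, ?_, ?_⟩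
    · have : Equiv.swap i k l ≠ i := by
        intro h
        apply h2
        have := congrArg (Equiv.swap i k) h
        simpa using this.symm
      simp [Equiv.swap_apply_of_ne_of_ne h1 this.symm]
    · simp
  rw [← Equiv.sum_comp (Equiv.mulRight τ) (fun σ : Equiv.Perm (Fin N) => f (σ k) (σ l))]
  simp only [Equiv.coe_mulRight, Equiv.Perm.mul_apply, hk, hl]

lemma perm_total {N : ℕ} (f : Fin N → Fin N → ℝ≥0∞) (h0 : ∀ s, f s s = 0) (i j : Fin N)
    (hij : i ≠ j) :
    (N : ℝ≥0∞) * ((N - 1 : ℕ) : ℝ≥0∞) * ∑ σ : Equiv.Perm (Fin N), f (σ i) (σ j)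
      = (Nat.factorial N : ℝ≥0∞) * ∑ s, ∑ t, f s t := by
  have e1 : ∀ σ : Equiv.Perm (Fin N), ∑ s, ∑ t, f (σ s) (σ t) = ∑ s, ∑ t, f s t := by
    intro σ
    rw [← Equiv.sum_comp σ (fun s => ∑ t, f s t)]
    exact Finset.sum_congr rfl fun s _ => Equiv.sum_comp σ (fun t => f (σ s) t)
  have e2 : ∑ σ : Equiv.Perm (Fin N), ∑ s, ∑ t, f (σ s) (σ t)
      = (Nat.factorial N : ℝ≥0∞) * ∑ s, ∑ t, f s t := by
    simp [e1, Finset.card_univ, Fintype.card_perm]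
  rw [← e2, Finset.sum_comm]
  have e3 : ∀ s : Fin N, ∑ σ : Equiv.Perm (Fin N), ∑ t, f (σ s) (σ t)
      = ((N - 1 : ℕ) : ℝ≥0∞) * ∑ σ : Equiv.Perm (Fin N), f (σ i) (σ j) := by
    intro s
    rw [Finset.sum_comm, ← Finset.add_sum_erase _ _ (Finset.mem_univ s)]
    simp only [h0, Finset.sum_const_zero, zero_add]
    rw [Finset.sum_congr rfl (g := fun _ => ∑ σ : Equiv.Perm (Fin N), f (σ i) (σ j))
      fun t ht => perm_pair f s t i j (Finset.ne_of_mem_erase ht).symm hij]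
    simp [Finset.card_erase_of_mem]
  simp [e3, mul_assoc]

lemma rec17 (A : ℕ → ℝ≥0∞) (B : ℝ≥0∞) (N : ℕ) (h2 : 2 * A 2 ≤ B)
    (h : ∀ r, 2 ≤ r → r < N →
      ((r : ℝ≥0∞) + 1) * A (r + 1) ≤ (r + 3) * A r + 2 * (r * B)) :
    ∀ k : ℕ, k + 2 ≤ N → 24 * A (k + 2) ≤ (11 * (k : ℝ≥0∞) ^ 2 + 29 * k + 12) * B := by
  intro k
  induction k with
  | zero =>
    intro _
    calc 24 * A (0 + 2) = 12 * (2 * A 2) := by ring_nf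
      _ ≤ 12 * B := by gcongr
      _ = _ := by simp
  | succ k ih =>
    intro hk
    have i1 := ih (by omega)
    have i2 := h (k + 2) (by omega) (by omega)
    push_cast at i2 ⊢
    have hne : ((k : ℝ≥0∞) + 2 + 1) ≠ 0 := by positivity
    have hnt : ((k : ℝ≥0∞) + 2 + 1) ≠ ⊤ := by finiteness
    rw [← ENNReal.mul_le_mul_iff_right hne hnt]
    calc ((k : ℝ≥0∞) + 2 + 1) * (24 * A (k + 1 + 2))
        = 24 * (((k : ℝ≥0∞) + 2 + 1) * A (k + 2 + 1)) := by
          rw [show k + 1 + 2 = k + 2 + 1 by ring]; ring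
      _ ≤ 24 * ((k + 2 + 3) * A (k + 2) + 2 * ((k + 2) * B)) := by gcongr
      _ = (k + 2 + 3) * (24 * A (k + 2)) + 48 * ((k + 2) * B) := by ring
      _ ≤ (k + 2 + 3) * ((11 * (k : ℝ≥0∞) ^ 2 + 29 * k + 12) * B) + 48 * ((k + 2) * B) := by
          gcongr
      _ = _ := by ring

/-- With equal weights `λ_i = 1/N`, if for each permutation `σ` the plan
`π̃_σ` is obtained by the greedy iteration applied to `μ^{σ(1)},…,μ^{σ(N)}`, then the
average cost over all `N!` permutations is at most `(1/12)(11N − 4 − 6/(N−1)) Φ(π̂)` for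
every optimal `π̂`; moreover `(1/12)(11N − 4 − 6/(N−1)) < N`. -/
theorem stmt17 {d N : ℕ} (hN : 2 ≤ N) (μ : Fin N → Measure (Pt d))
    (hμ : ∀ i, IsProbabilityMeasure (μ i) ∧ FinitelySupported (μ i))
    (P : Equiv.Perm (Fin N) → (r : ℕ) → Measure (Fin r → Pt d))
    (hP1 : ∀ σ : Equiv.Perm (Fin N),
      P σ 1 = (μ (σ ⟨0, by omega⟩)).map (fun y => fun _ : Fin 1 => y))
    (hstep : ∀ σ : Equiv.Perm (Fin N), ∀ r : ℕ, 1 ≤ r → ∀ hr : r < N,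
      GreedyStep (fun _ : Fin r => (1 : ℝ) / N) (P σ r) (μ (σ ⟨r, hr⟩)) (P σ (r + 1))) :
    (∀ pihat, IsPlan μ pihat →
      (∀ π, IsPlan μ π → MOT (fun _ => (1 : ℝ) / N) pihat ≤ MOT (fun _ => (1 : ℝ) / N) π) →
      ∑ σ : Equiv.Perm (Fin N), MOT (fun _ => (1 : ℝ) / N) (P σ N)
        ≤ (Nat.factorial N : ℝ≥0∞)
            * ENNReal.ofReal ((11 * (N : ℝ) - 4 - 6 / ((N : ℝ) - 1)) / 12)
            * MOT (fun _ => (1 : ℝ) / N) pihat)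
    ∧ (11 * (N : ℝ) - 4 - 6 / ((N : ℝ) - 1)) / 12 < N := by
  have hN0 : (N : ℝ) ≠ 0 := by positivity
  have hc : (1 : ℝ) / N ≠ 0 := by positivity
  refine ⟨?_, ?_⟩
  · intro pihat hplan _
    obtain ⟨hprob, hmarg⟩ := hplan
    -- marginals of the greedy plans
    have hmP : ∀ σ : Equiv.Perm (Fin N), ∀ r : ℕ, 1 ≤ r → ∀ hr : r ≤ N,
        IsProbabilityMeasure (P σ r) ∧
        ∀ j : Fin r, (P σ r).map (fun x => x j) = μ (σ ⟨j, j.2.trans_le hr⟩) := by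
      intro σ r h1
      induction r, h1 using Nat.le_induction with
      | base =>
        intro hr
        have := (hμ (σ ⟨0, by omega⟩)).1
        rw [hP1]
        refine ⟨Measure.isProbabilityMeasure_map (by fun_prop), fun j => ?_⟩
        rw [Measure.map_map (by fun_prop) (by fun_prop)]
        have e : (⟨j, j.2.trans_le hr⟩ : Fin N) = ⟨0, by omega⟩ := by
          ext; simp
        rw [e]
        exact Measure.map_id
      | succ r h1 ih =>
        intro hr
        obtain ⟨i1, i2⟩ := ih (by omega)
        obtain ⟨⟨s1, s2, s3⟩, _⟩ := hstep σ r h1 (by omega)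
        refine ⟨s1, fun j => ?_⟩
        refine Fin.lastCases ?_ (fun j => ?_) j
        · exact s3
        · have := i2 j
          rw [← s2, Measure.map_map (by fun_prop) (by fun_prop)] at this
          exact this
    -- two-marginals of pihat
    let ρ : Fin N → Fin N → Measure (Pt d × Pt d) := fun s t => pihat.map fun x => (x s, x t)
    have hρ : ∀ s t, IsProbabilityMeasure (ρ s t) := fun s t =>
      Measure.isProbabilityMeasure_map (by fun_prop)
    have hρ1 : ∀ s t, (ρ s t).fst = μ s := by
      intro s t
      rw [Measure.fst, Measure.map_map (by fun_prop) (by fun_prop), ← hmarg s]; rfl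
    have hρ2 : ∀ s t, (ρ s t).snd = μ t := by
      intro s t
      rw [Measure.snd, Measure.map_map (by fun_prop) (by fun_prop), ← hmarg t]; rfl
    have hρb : ∀ s t, ∫⁻ p, ENNReal.ofReal (‖p.1 - p.2‖ ^ 2) ∂(ρ s t) = b17 pihat s t := by
      intro s t
      rw [lintegral_map (by fun_prop) (by fun_prop)]; rfl
    set i0 : Fin N := ⟨0, by omega⟩ with hi0
    set i1 : Fin N := ⟨1, by omega⟩ with hi1
    have hi : i0 ≠ i1 := by simp [hi0, hi1]
    set B : ℝ≥0∞ := ∑ σ : Equiv.Perm (Fin N), b17 pihat (σ i0) (σ i1) with hB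
    let A : ℕ → ℝ≥0∞ := fun r => ∑ σ : Equiv.Perm (Fin N), S17 (P σ r)
    have hA2 : 2 * A 2 ≤ B := by
      simp only [A, hB, Finset.mul_sum]
      refine Finset.sum_le_sum fun σ _ => ?_
      have g := hstep σ 1 le_rfl (by omega)
      obtain ⟨p1, p2⟩ := hmP σ 1 le_rfl (by omega)
      have e := S_succ le_rfl _ hc _ _ _ g.1
      have bd := step_bound_one _ hc _ _ _ g (ρ (σ i0) (σ i1)) (by rw [hρ1]; exact p2 0)
        (hρ2 _ _)
      rw [hρb] at bd
      rw [S_one] at e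
      have e' : 2 * S17 (P σ 2) = greedyCost (fun _ => (1 : ℝ) / N) (P σ (1 + 1)) := by
        simpa [one_add_one_eq_two] using e
      rw [e']
      exact bd
    have hrec : ∀ r, 2 ≤ r → r < N →
        ((r : ℝ≥0∞) + 1) * A (r + 1) ≤ (r + 3) * A r + 2 * (r * B) := by
      intro r h2 hr
      have hr1 : 1 ≤ r := by omega
      have each : ∀ σ : Equiv.Perm (Fin N), ((r : ℝ≥0∞) + 1) * S17 (P σ (r + 1))
          ≤ (r + 3) * S17 (P σ r)
            + 2 * ∑ j : Fin r, b17 pihat (σ ⟨j, j.2.trans hr⟩) (σ ⟨r, hr⟩) := by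
        intro σ
        have g := hstep σ r hr1 hr
        obtain ⟨p1, p2⟩ := hmP σ r hr1 hr.le
        rw [S_succ hr1 _ hc _ _ _ g.1]
        have bd : ∀ j : Fin r, greedyCost (fun _ => (1 : ℝ) / N) (P σ (r + 1))
            ≤ 2 * ∫⁻ x, ENNReal.ofReal (‖mean17 x - x j‖ ^ 2) ∂(P σ r)
              + 2 * b17 pihat (σ ⟨j, j.2.trans hr⟩) (σ ⟨r, hr⟩) := by
          intro j
          rw [← hρb]
          exact step_bound hr1 _ hc _ _ _ g j _ (by rw [hρ1]; exact p2 j) (hρ2 _ _)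
        have sm := Finset.sum_le_sum fun (j : Fin r) (_ : j ∈ Finset.univ) => bd j
        rw [Finset.sum_add_distrib, ← Finset.mul_sum, ← Finset.mul_sum,
          ← lintegral_finsetSum _ (fun j _ => by fun_prop)] at sm
        simp only [Finset.sum_const, Finset.card_univ, Fintype.card_fin, nsmul_eq_mul] at sm
        change _ ≤ 2 * S17 (P σ r) + _ at sm
        calc _ ≤ ((r : ℝ≥0∞) + 1) * S17 (P σ r) + (2 * S17 (P σ r) +
              2 * ∑ j : Fin r, b17 pihat (σ ⟨j, j.2.trans hr⟩) (σ ⟨r, hr⟩)) := by gcongr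
          _ = _ := by ring
      have sm := Finset.sum_le_sum
        fun (σ : Equiv.Perm (Fin N)) (_ : σ ∈ Finset.univ) => each σ
      rw [Finset.sum_add_distrib, ← Finset.mul_sum, ← Finset.mul_sum, ← Finset.mul_sum,
        Finset.sum_comm] at sm
      have e : ∀ j : Fin r, ∑ σ : Equiv.Perm (Fin N),
          b17 pihat (σ ⟨j, j.2.trans hr⟩) (σ ⟨r, hr⟩) = B := by
        intro j
        refine perm_pair (b17 pihat) _ _ _ _ ?_ hi
        intro h
        have := congrArg Fin.val h
        have := j.2
        simp at *
        omega
      simp only [e, Finset.sum_const, Finset.card_univ, Fintype.card_fin, nsmul_eq_mul] at sm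
      exact sm
    obtain ⟨k, rfl⟩ : ∃ k, N = k + 2 := ⟨N - 2, by omega⟩
    have fin := rec17 A B (k + 2) hA2 hrec k le_rfl
    have tot := perm_total (b17 pihat) (b17_self pihat) i0 i1 hi
    rw [MOT_b (by omega), ← hB] at tot
    set M := MOT (fun _ => (1 : ℝ) / ((k + 2 : ℕ) : ℝ)) pihat
    set L := ∑ σ : Equiv.Perm (Fin (k + 2)),
      MOT (fun _ => (1 : ℝ) / ((k + 2 : ℕ) : ℝ)) (P σ (k + 2)) with hL
    have hAL : A (k + 2) = ((k + 2 : ℕ) : ℝ≥0∞) * L := by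
      rw [hL, Finset.mul_sum]
      exact Finset.sum_congr rfl fun σ _ => (MOT_eq_s17 (by omega) _).symm
    rw [hAL] at fin
    set n : ℝ≥0∞ := ((k + 2 : ℕ) : ℝ≥0∞) with hn
    set F : ℝ≥0∞ := (Nat.factorial (k + 2) : ℝ≥0∞)
    have hn0 : n ≠ 0 := by simp [hn]
    have hnt : n ≠ ⊤ := by simp [hn]
    have hk1 : ((k + 2 - 1 : ℕ) : ℝ≥0∞) = (k : ℝ≥0∞) + 1 := by
      rw [show k + 2 - 1 = k + 1 by omega]; push_cast; rfl
    rw [hk1] at tot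
    have tot' : ((k : ℝ≥0∞) + 1) * B = 2 * n * F * M := by
      rw [← ENNReal.mul_right_inj hn0 hnt, ← mul_assoc, tot]
      ring
    set C : ℝ≥0∞ := ENNReal.ofReal ((11 * ((k + 2 : ℕ) : ℝ) - 4 - 6 / (((k + 2 : ℕ) : ℝ) - 1)) / 12)
      with hC
    have hCC : 12 * ((k : ℝ≥0∞) + 1) * C = 11 * (k : ℝ≥0∞) ^ 2 + 29 * k + 12 := by
      have e1 : 12 * ((k : ℝ≥0∞) + 1) = ENNReal.ofReal (12 * ((k : ℝ) + 1)) := by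
        rw [ENNReal.ofReal_mul (by positivity), ENNReal.ofReal_add (by positivity) (by positivity)]
        simp
      have e2 : 11 * (k : ℝ≥0∞) ^ 2 + 29 * k + 12
          = ENNReal.ofReal (11 * (k : ℝ) ^ 2 + 29 * k + 12) := by
        rw [ENNReal.ofReal_add (by positivity) (by positivity),
          ENNReal.ofReal_add (by positivity) (by positivity), ENNReal.ofReal_mul (by positivity),
          ENNReal.ofReal_mul (by positivity), ENNReal.ofReal_pow (by positivity)]
        simp
      rw [e1, e2, hC, ← ENNReal.ofReal_mul (by positivity)]
      congr 1
      push_cast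
      have : (k : ℝ) + 2 - 1 ≠ 0 := by
        have : (0 : ℝ) ≤ k := by positivity
        linarith
      field_simp
      ring
    have hz0 : 24 * n * ((k : ℝ≥0∞) + 1) ≠ 0 := by
      simp [hn0]
    have hzt : 24 * n * ((k : ℝ≥0∞) + 1) ≠ ⊤ := by finiteness
    rw [← ENNReal.mul_le_mul_iff_right hz0 hzt]
    calc 24 * n * ((k : ℝ≥0∞) + 1) * L = (k + 1) * (24 * (n * L)) := by ring
      _ ≤ (k + 1) * ((11 * (k : ℝ≥0∞) ^ 2 + 29 * k + 12) * B) := by gcongr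
      _ = (11 * (k : ℝ≥0∞) ^ 2 + 29 * k + 12) * (((k : ℝ≥0∞) + 1) * B) := by ring
      _ = 24 * n * ((k : ℝ≥0∞) + 1) * (F * C * M) := by
          rw [tot', ← hCC]; ring
  · have h2 : (2 : ℝ) ≤ N := by exact_mod_cast hN
    have : 0 < 6 / ((N : ℝ) - 1) := by
      apply div_pos <;> linarith
    linarith
end
end
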